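/- Let A ∈ ℝ^{d₁×n} and B ∈ ℝ^{d₂×n} be nonzero matrices with columns a₁,…,aₙ and b₁,…,bₙ, such that for every i ∈ [n] at least one of aᵢ, bᵢ is nonzero, and define pᵢ = (‖aᵢ‖²/‖A‖_F² + ‖bᵢ‖²/‖B‖_F²)/2. Then ‖∑_{i=1}^n (1/pᵢ)·‖bᵢ‖²·aᵢaᵢᵀ‖ ≤ 2·‖B‖_F²·‖A‖², where ‖·‖ is the spectral norm. -/

import Mathlib

open Matrix MeasureTheory

/-- The spectral norm (ℓ₂ operator norm) of a real matrix. -/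
noncomputable def specNorm {d n : ℕ} (M : Matrix (Fin d) (Fin n) ℝ) : ℝ :=
  ‖LinearMap.toContinuousLinearMap (Matrix.toEuclideanLin M)‖

/-- The Frobenius norm of a real matrix. -/
noncomputable def frobNorm {d n : ℕ} (M : Matrix (Fin d) (Fin n) ℝ) : ℝ :=
  Real.sqrt (∑ i, ∑ j, (M i j) ^ 2)

/-- The stable rank of a matrix: `‖M‖_F² / ‖M‖²`. -/
noncomputable def srank {d n : ℕ} (M : Matrix (Fin d) (Fin n) ℝ) : ℝ :=
  frobNorm M ^ 2 / specNorm M ^ 2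

/-- The Euclidean norm of a vector (e.g. a column of a matrix). -/
noncomputable def colNorm {d : ℕ} (v : Fin d → ℝ) : ℝ := Real.sqrt (∑ i, v i ^ 2)

open scoped Matrix.Norms.L2Operator in
lemma specNorm_eq_l2_opNorm {d n : ℕ} (M : Matrix (Fin d) (Fin n) ℝ) : specNorm M = ‖M‖ := by
  rw [specNorm, Matrix.l2_opNorm_def]
  rfl

lemma frobNorm_pos {d n : ℕ} {M : Matrix (Fin d) (Fin n) ℝ} (hM : M ≠ 0) : 0 < frobNorm M := by
  obtain ⟨k, l, hkl⟩ : ∃ k l, M k l ≠ 0 := by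
    by_contra! h
    exact hM (Matrix.ext h)
  refine Real.sqrt_pos.2 (Finset.sum_pos' (fun i _ => Finset.sum_nonneg fun j _ => sq_nonneg _)
    ⟨k, Finset.mem_univ k, ?_⟩)
  exact Finset.sum_pos' (fun j _ => sq_nonneg _) ⟨l, Finset.mem_univ l, by positivity⟩

lemma sum_smul_vecMulVec_col_eq_mul_diagonal_mul_transpose {m n : ℕ}
    (A : Matrix (Fin m) (Fin n) ℝ) (w : Fin n → ℝ) :
    ∑ i, w i • Matrix.vecMulVec (A · i) (A · i) = A * Matrix.diagonal w * Aᵀ := by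
  ext k l
  rw [Matrix.mul_apply]
  simp only [Matrix.sum_apply, Matrix.smul_apply, Matrix.vecMulVec_apply, smul_eq_mul,
    Matrix.mul_diagonal, Matrix.transpose_apply]
  exact Finset.sum_congr rfl fun i _ => by ring

open scoped Matrix.Norms.L2Operator in
/-- A congruence `A * diagonal w * Aᵀ` has spectral norm at most `c * ‖A‖ ^ 2` when all weights
are bounded by `c` in absolute value. -/
lemma specNorm_mul_diagonal_mul_transpose_le {m n : ℕ} (A : Matrix (Fin m) (Fin n) ℝ)
    {w : Fin n → ℝ} {c : ℝ} (hc : 0 ≤ c) (hw : ∀ i, |w i| ≤ c) :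
    specNorm (A * Matrix.diagonal w * Aᵀ) ≤ c * specNorm A ^ 2 := by
  simp only [specNorm_eq_l2_opNorm]
  have hD : ‖(Matrix.diagonal w : Matrix (Fin n) (Fin n) ℝ)‖ ≤ c := by
    rw [Matrix.l2_opNorm_diagonal]
    exact (pi_norm_le_iff_of_nonneg hc).2 hw
  have hT : ‖Aᵀ‖ = ‖A‖ := by
    rw [← Matrix.conjTranspose_eq_transpose_of_trivial, Matrix.l2_opNorm_conjTranspose]
  calc ‖A * Matrix.diagonal w * Aᵀ‖
      ≤ ‖A‖ * ‖(Matrix.diagonal w : Matrix (Fin n) (Fin n) ℝ)‖ * ‖Aᵀ‖ :=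
        (Matrix.l2_opNorm_mul _ _).trans
          (mul_le_mul_of_nonneg_right (Matrix.l2_opNorm_mul _ _) (norm_nonneg _))
    _ ≤ ‖A‖ * c * ‖A‖ := by rw [hT]; gcongr
    _ = c * ‖A‖ ^ 2 := by ring

/-- `‖∑ᵢ (1/pᵢ)·‖bᵢ‖²·aᵢaᵢᵀ‖ ≤ 2·‖B‖_F²·‖A‖²` for the mixed column-norm sampling
probabilities. -/
theorem stmt7 {d₁ d₂ n : ℕ}
    (A : Matrix (Fin d₁) (Fin n) ℝ) (B : Matrix (Fin d₂) (Fin n) ℝ)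
    (hA : A ≠ 0) (hB : B ≠ 0)
    (hcol : ∀ i : Fin n, (fun k => A k i) ≠ 0 ∨ (fun k => B k i) ≠ 0)
    (p : Fin n → ℝ)
    (hp : ∀ i : Fin n, p i =
      (colNorm (A · i) ^ 2 / frobNorm A ^ 2 + colNorm (B · i) ^ 2 / frobNorm B ^ 2) / 2) :
    specNorm (∑ i : Fin n, ((1 / p i) * colNorm (B · i) ^ 2) •
        Matrix.vecMulVec (A · i) (A · i))
      ≤ 2 * frobNorm B ^ 2 * specNorm A ^ 2 := by
  rw [sum_smul_vecMulVec_col_eq_mul_diagonal_mul_transpose]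
  refine specNorm_mul_diagonal_mul_transpose_le A (by positivity) fun i => ?_
  have hF := frobNorm_pos hB
  have hp0 : 0 ≤ p i := by rw [hp]; positivity
  rw [abs_of_nonneg (by positivity), one_div_mul_eq_div]
  refine div_le_of_le_mul₀ hp0 (by positivity) ?_
  have ha : 0 ≤ frobNorm B ^ 2 * (colNorm (A · i) ^ 2 / frobNorm A ^ 2) := by positivity
  have hb : frobNorm B ^ 2 * (colNorm (B · i) ^ 2 / frobNorm B ^ 2) = colNorm (B · i) ^ 2 :=
    mul_div_cancel₀ _ (by positivity)
  rw [hp]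
  linarith
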